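/- arXiv:1603.07812 — 2 statements merged into one kernel-verified Lean document; each statement's English description precedes it below -/
import Mathlib

section
/- Let T be a positive contraction of L¹(μ) with adjoint satisfying T*1 = 1. If ‖T^{m+1} − T^m‖ < 2 for some m ∈ ℕ₀, then lim_{n→∞} ‖T^{n+1} − Tⁿ‖ = 0. -/
open MeasureTheory Filter

/-- Antitone nonnegative sequences converge to a nonnegative lower bound. -/
lemma zt_lim (a : ℕ → ℝ) (ha : Antitone a) (h0 : ∀ n, 0 ≤ a n) :
    ∃ r, 0 ≤ r ∧ (∀ n, r ≤ a n) ∧ Tendsto a atTop (nhds r) := by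
  have hb : BddBelow (Set.range a) := ⟨0, by rintro _ ⟨n, rfl⟩; exact h0 n⟩
  exact ⟨⨅ n, a n, le_ciInf h0, fun n => ciInf_le hb n, tendsto_atTop_ciInf ha hb⟩

lemma zt_pow {R : Type*} [NormedRing R] (h1 : ‖(1 : R)‖ ≤ 1) (T : R) (hT : ‖T‖ ≤ 1) (n : ℕ) :
    ‖T ^ n‖ ≤ 1 := by
  induction n with
  | zero => simpa using h1
  | succ n ih =>
    rw [pow_succ]
    exact (norm_mul_le _ _).trans (mul_le_one₀ ih (norm_nonneg _) hT)

lemma zt_mul {R : Type*} [NormedRing R] (a b : R) (ha : ‖a‖ ≤ 1) : ‖a * b‖ ≤ ‖b‖ :=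
  (norm_mul_le _ _).trans (mul_le_of_le_one_left (norm_nonneg _) ha)

/-- Ishikawa-type argument: for V = (1 + T)/2, the norms of V^k (1 - T) tend to zero. -/
lemma zt_ishikawa {R : Type*} [NormedRing R] [NormedAlgebra ℝ R] (h1 : ‖(1 : R)‖ ≤ 1)
    (T V : R) (hT : ‖T‖ ≤ 1) (hV : V = (1 / 2 : ℝ) • (1 + T)) :
    ‖V‖ ≤ 1 ∧ Tendsto (fun k : ℕ => ‖V ^ k * (1 - T)‖) atTop (nhds 0) := by
  have hVn : ‖V‖ ≤ 1 := by
    rw [hV, norm_smul]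
    have := norm_add_le (1 : R) T
    norm_num
    linarith
  refine ⟨hVn, ?_⟩
  have hVT : Commute V T := by
    rw [hV]
    exact Commute.smul_left ((Commute.one_left T).add_left (Commute.refl T)) _
  have hD : ∀ k, V ^ k - V ^ (k + 1) = (1 / 2 : ℝ) • (V ^ k * (1 - T)) := by
    intro k
    have : V ^ (k + 1) = (1 / 2 : ℝ) • (V ^ k * (1 + T)) := by
      rw [pow_succ, ← mul_smul_comm, ← hV]
    rw [this, mul_add, mul_sub, mul_one]
    module
  obtain ⟨r, hr0, hr, hlim⟩ := zt_lim (fun k : ℕ => ‖V ^ k * (1 - T)‖)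
    (antitone_nat_of_succ_le fun k => by
      rw [pow_succ', mul_assoc]; exact zt_mul _ _ hVn) (fun _ => norm_nonneg _)
  have hanti : ∀ i k, ‖V ^ (i + k) * (1 - T)‖ ≤ ‖V ^ i * (1 - T)‖ := by
    intro i k
    rw [add_comm, pow_add, mul_assoc]; exact zt_mul _ _ (zt_pow h1 _ hVn _)
  have htel : ∀ i n : ℕ, ‖V ^ i - V ^ (i + n)‖ ≤ n * (‖V ^ i * (1 - T)‖ / 2) := by
    intro i n
    induction n with
    | zero => simp
    | succ n ih =>
      have e : V ^ i - V ^ (i + (n + 1)) = (V ^ i - V ^ (i + n)) +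
          (V ^ (i + n) - V ^ (i + n + 1)) := by rw [← add_assoc]; abel
      rw [e]
      refine (norm_add_le _ _).trans ?_
      rw [hD (i + n), norm_smul]
      have := hanti i n
      push_cast
      norm_num
      linarith
  have hstep : ∀ i n : ℕ, ‖V ^ (i + 1) - T * V ^ (i + 1 + n)‖ ≤
      ‖V ^ i - T * V ^ (i + (n + 1))‖ / 2 + (n + 1) * (‖V ^ i * (1 - T)‖ / 4) := by
    intro i n
    have e : V ^ (i + 1) - T * V ^ (i + 1 + n) = (1 / 2 : ℝ) • (V ^ i - T * V ^ (i + (n + 1)))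
        + (1 / 2 : ℝ) • (T * (V ^ i - V ^ (i + (n + 1)))) := by
      have e1 : V ^ (i + 1) = (1 / 2 : ℝ) • (V ^ i + T * V ^ i) := by
        rw [pow_succ']; nth_rw 1 [hV]; rw [smul_mul_assoc, add_mul, one_mul]
      rw [show i + 1 + n = i + (n + 1) by ring, e1, mul_sub]
      module
    rw [e]
    refine (norm_add_le _ _).trans ?_
    rw [norm_smul, norm_smul]
    have h2 := zt_mul T (V ^ i - V ^ (i + (n + 1))) hT
    have h3 := htel i (n + 1)
    push_cast at h3
    norm_num
    linarith
  have hbanti : ∀ i k n, ‖V ^ (i + k) - T * V ^ (i + k + n)‖ ≤ ‖V ^ i - T * V ^ (i + n)‖ := by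
    intro i k n
    have : V ^ (i + k) - T * V ^ (i + k + n) = V ^ k * (V ^ i - T * V ^ (i + n)) := by
      rw [mul_sub, ← mul_assoc, (hVT.pow_left k).eq, mul_assoc, ← pow_add, ← pow_add]
      congr 2 <;> ring_nf
    rw [this]
    exact zt_mul _ _ (zt_pow h1 _ hVn _)
  have hlow : ∀ n i : ℕ, (1 + n / 2 : ℝ) * r ≤ ‖V ^ i - T * V ^ (i + n)‖ := by
    intro n
    induction n with
    | zero =>
      intro i
      have := hr i
      rw [mul_sub, mul_one, (hVT.pow_left i).eq] at this
      simpa using this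
    | succ n ih =>
      intro i
      have hk : ∀ k, 2 * ((1 + n / 2 : ℝ) * r) - (n + 1) * (‖V ^ (k + i) * (1 - T)‖ / 2) ≤
          ‖V ^ i - T * V ^ (i + (n + 1))‖ := by
        intro k
        have a1 := ih (i + k + 1)
        have a2 := hstep (i + k) n
        have a3 := hbanti i k (n + 1)
        rw [add_comm k i]
        linarith
      have hl : Tendsto (fun k : ℕ => 2 * ((1 + n / 2 : ℝ) * r) -
          (n + 1) * (‖V ^ (k + i) * (1 - T)‖ / 2)) atTop
          (nhds (2 * ((1 + n / 2 : ℝ) * r) - (n + 1) * (r / 2))) :=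
        (((((tendsto_add_atTop_iff_nat i).2 hlim).div_const 2).const_mul _)).const_sub _
      have := le_of_tendsto' hl hk
      push_cast
      linarith
  have hr' : r = 0 := by
    by_contra hne
    have hpos : 0 < r := lt_of_le_of_ne hr0 (Ne.symm hne)
    obtain ⟨n, hn⟩ := exists_nat_gt (4 / r)
    rw [div_lt_iff₀ hpos] at hn
    have b1 := hlow n 0
    have b2 := norm_sub_le (V ^ 0) (T * V ^ (0 + n))
    have b3 := zt_pow h1 V hVn 0
    have b4 := zt_mul T (V ^ (0 + n)) hT
    have b5 := zt_pow h1 V hVn (0 + n)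
    nlinarith
  rw [hr'] at hlim
  exact hlim

/-- The doubly indexed recursion forces decay. -/
lemma zt_rec (A : ℕ → ℕ → ℝ) (δ : ℝ) (hδ : 0 < δ) (h0 : ∀ k n, 0 ≤ A k n)
    (hn : ∀ k, Antitone (A k)) 
    (hrec : ∀ k n, A k (n + 1) ≤ δ * A (k + 1) n + (1 - δ) * A k n)
    (hlim : Tendsto (fun k => A k 0) atTop (nhds 0)) : Tendsto (A 0) atTop (nhds 0) := by
  choose L hL0 hLle hL using fun k => zt_lim (A k) (hn k) (h0 k)
  have h1 : ∀ k, L k ≤ L (k + 1) := by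
    intro k
    have := le_of_tendsto_of_tendsto' ((tendsto_add_atTop_iff_nat 1).2 (hL k))
      (((hL (k + 1)).const_mul δ).add ((hL k).const_mul (1 - δ))) (hrec k)
    nlinarith
  have h2 : ∀ k, L 0 ≤ A k 0 := fun k =>
    (monotone_nat_of_le_succ h1 (Nat.zero_le k)).trans (hLle k 0)
  have h3 : L 0 ≤ 0 := ge_of_tendsto' hlim h2
  have h4 : L 0 = 0 := le_antisymm h3 (hL0 0)
  have := hL 0
  rwa [h4] at this

section L1
variable {X : Type*} [MeasurableSpace X] {μ : Measure X}

lemma zt_norm_pos (f : Lp ℝ 1 μ) (hf : 0 ≤ f) : ‖f‖ = L1.integral f := by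
  rw [L1.norm_eq_integral_norm, L1.integral_eq_integral]
  refine integral_congr_ae ?_
  filter_upwards [(Lp.coeFn_nonneg f).2 hf] with x hx
  exact Real.norm_of_nonneg hx

lemma zt_half_nonneg (f : Lp ℝ 1 μ) (hf : 0 ≤ f) : 0 ≤ (1 / 2 : ℝ) • f := by
  rw [← Lp.coeFn_nonneg]
  filter_upwards [(Lp.coeFn_nonneg f).2 hf, Lp.coeFn_smul (1 / 2 : ℝ) f] with x hx h2
  rw [h2]
  exact mul_nonneg (by norm_num) hx

lemma zt_norm_add (f g : Lp ℝ 1 μ) (hf : 0 ≤ f) (hg : 0 ≤ g) : ‖f + g‖ = ‖f‖ + ‖g‖ := by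
  rw [zt_norm_pos _ hf, zt_norm_pos _ hg, zt_norm_pos _ (add_nonneg hf hg), L1.integral_add]

lemma zt_norm_inf (f g : Lp ℝ 1 μ) (hf : 0 ≤ f) (hg : 0 ≤ g) :
    ‖f‖ + ‖g‖ = ‖f - g‖ + 2 * ‖f ⊓ g‖ := by
  have e : f + g = |f - g| + (f ⊓ g + f ⊓ g) := by
    have := two_nsmul_inf_eq_add_sub_abs_sub f g
    rw [two_nsmul] at this
    rw [this, abs_sub_comm]; abel
  have hi : 0 ≤ f ⊓ g := le_inf hf hg
  rw [← zt_norm_add f g hf hg, e, zt_norm_add _ _ (abs_nonneg _) (add_nonneg hi hi),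
    zt_norm_add _ _ hi hi, norm_abs_eq_norm]
  ring

lemma zt_opNorm (S : Lp ℝ 1 μ →L[ℝ] Lp ℝ 1 μ) (c : ℝ) (hc : 0 ≤ c)
    (h : ∀ f : Lp ℝ 1 μ, 0 ≤ f → ‖S f‖ ≤ c * ‖f‖) : ‖S‖ ≤ c := by
  refine S.opNorm_le_bound hc fun f => ?_
  have e1 : ‖f‖ = ‖f⁺‖ + ‖f⁻‖ := by
    rw [← zt_norm_add _ _ (posPart_nonneg f) (negPart_nonneg f), posPart_add_negPart,
      norm_abs_eq_norm]
  have e2 : S f = S f⁺ - S f⁻ := by rw [← map_sub, posPart_sub_negPart]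
  rw [e1, e2]
  have := norm_sub_le (S f⁺) (S f⁻)
  have := h _ (posPart_nonneg f)
  have := h _ (negPart_nonneg f)
  linarith

end L1

theorem stmt9 {X : Type*} [MeasurableSpace X] (μ : Measure X)
    (T : Lp ℝ 1 μ →L[ℝ] Lp ℝ 1 μ)
    (hTpos : ∀ f : Lp ℝ 1 μ, 0 ≤ f → 0 ≤ T f) (hTnorm : ‖T‖ ≤ 1)
    (hTunital : ∀ f : Lp ℝ 1 μ, L1.integral (T f) = L1.integral f)
    (m : ℕ) (hm : ‖T ^ (m + 1) - T ^ m‖ < 2) :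
    Tendsto (fun n : ℕ => ‖T ^ (n + 1) - T ^ n‖) atTop (nhds 0) := by
  have h1 : ‖(1 : Lp ℝ 1 μ →L[ℝ] Lp ℝ 1 μ)‖ ≤ 1 := ContinuousLinearMap.norm_id_le
  have hpp : ∀ n : ℕ, ∀ f : Lp ℝ 1 μ, 0 ≤ f → 0 ≤ (T ^ n) f := by
    intro n
    induction n with
    | zero => intro f hf; simpa using hf
    | succ n ih => intro f hf; rw [pow_succ']; exact hTpos _ (ih f hf)
  have hTn : ∀ f : Lp ℝ 1 μ, 0 ≤ f → ‖T f‖ = ‖f‖ := by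
    intro f hf
    rw [zt_norm_pos _ hf, zt_norm_pos _ (hTpos f hf), hTunital]
  have hpn : ∀ n : ℕ, ∀ f : Lp ℝ 1 μ, 0 ≤ f → ‖(T ^ n) f‖ = ‖f‖ := by
    intro n
    induction n with
    | zero => intro f hf; simp
    | succ n ih =>
      intro f hf; rw [pow_succ', ← ih f hf]; exact hTn _ (hpp n f hf)
  obtain ⟨V, hV⟩ : ∃ V, V = (1 / 2 : ℝ) • (1 + T) := ⟨_, rfl⟩
  obtain ⟨hVn, hVlim⟩ := zt_ishikawa h1 T V hTnorm hV
  have hVT : Commute V T := by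
    rw [hV]
    exact Commute.smul_left ((Commute.one_left T).add_left (Commute.refl T)) _
  obtain ⟨U, hU⟩ : ∃ U, U = T ^ (m + 1) := ⟨_, rfl⟩
  have hUn : ‖U‖ ≤ 1 := hU ▸ zt_pow h1 T hTnorm _
  have hVU : Commute V U := hU ▸ hVT.pow_right _
  have hDV : Commute (1 - T) V := (Commute.one_left V).sub_left hVT.symm
  have hDU : Commute (1 - T) U := (Commute.one_left U).sub_left (hU ▸ Commute.self_pow T _)
  obtain ⟨δ, hδ⟩ : ∃ δ, δ = (2 - ‖T ^ (m + 1) - T ^ m‖) / 2 := ⟨_, rfl⟩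
  have hδ0 : 0 < δ := by rw [hδ]; linarith
  have hδ1 : δ ≤ 1 := by
    rw [hδ]; linarith [norm_nonneg (T ^ (m + 1) - T ^ m)]
  have key := zt_rec (fun k n => ‖(1 - T) * V ^ k * U ^ n‖) δ hδ0 (fun _ _ => norm_nonneg _)
    (fun k => antitone_nat_of_succ_le fun n => by
      have : (1 - T) * V ^ k * U ^ (n + 1) = U * ((1 - T) * V ^ k * U ^ n) := by
        rw [pow_succ', ← mul_assoc, ← mul_assoc, (hDU.mul_left (hVU.pow_left k)).eq]
      rw [this]; exact zt_mul _ _ hUn)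
    (fun k n => by
      have hk : ‖(1 - T) * V ^ (k + 1) * U ^ n‖ ≤ ‖(1 - T) * V ^ k * U ^ n‖ := by
        have : (1 - T) * V ^ (k + 1) * U ^ n = V * ((1 - T) * V ^ k * U ^ n) := by
          rw [pow_succ', ← mul_assoc, hDV.eq]
          simp only [mul_assoc]
        rw [this]; exact zt_mul _ _ hVn
      have p1 := norm_nonneg ((1 - T) * V ^ (k + 1) * U ^ n)
      have p2 := norm_nonneg ((1 - T) * V ^ k * U ^ n)
      refine zt_opNorm _ _ (add_nonneg (mul_nonneg hδ0.le p1)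
        (mul_nonneg (by linarith) p2)) fun f hf => ?_
      obtain ⟨q, hq⟩ : ∃ q, q = (T ^ (m + 1)) f ⊓ (T ^ m) f := ⟨_, rfl⟩
      have hq0 : 0 ≤ q := hq ▸ le_inf (hpp _ f hf) (hpp _ f hf)
      have hqn : δ * ‖f‖ ≤ ‖q‖ := by
        have i1 := zt_norm_inf _ _ (hpp (m + 1) f hf) (hpp m f hf)
        rw [hpn _ f hf, hpn _ f hf, ← hq] at i1
        have i2 := (T ^ (m + 1) - T ^ m).le_opNorm f
        rw [sub_apply] at i2
        rw [hδ]
        linarith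
      have hVq : V q = (1 / 2 : ℝ) • (q + T q) := by rw [hV]; rfl
      have hr1 : q ≤ U f := by rw [hq, hU]; exact inf_le_left
      have hr2 : T q ≤ U f := by
        have : 0 ≤ T ((T ^ m) f - q) := hTpos _ (sub_nonneg.2 (hq ▸ inf_le_right))
        rw [map_sub, sub_nonneg] at this
        rw [hU, pow_succ']; exact this
      obtain ⟨r, hr⟩ : ∃ r, r = U f - V q := ⟨_, rfl⟩
      have hr0 : 0 ≤ r := by
        have : r = (1 / 2 : ℝ) • ((U f - q) + (U f - T q)) := by rw [hr, hVq]; module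
        rw [this]
        exact zt_half_nonneg _ (add_nonneg (sub_nonneg.2 hr1) (sub_nonneg.2 hr2))
      have hVq0 : 0 ≤ V q := by
        rw [hVq]; exact zt_half_nonneg _ (add_nonneg hq0 (hTpos _ hq0))
      have hVqn : ‖V q‖ = ‖q‖ := by
        rw [hVq, norm_smul, zt_norm_add _ _ hq0 (hTpos _ hq0), hTn _ hq0]
        norm_num
        ring
      have hUf : U f = V q + r := by rw [hr]; abel
      have hrn : ‖r‖ = ‖f‖ - ‖q‖ := by
        have := zt_norm_add _ _ hVq0 hr0
        rw [← hUf, hU, hpn _ f hf, hVqn] at this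
        linarith
      have hdec : ((1 - T) * V ^ k * U ^ (n + 1)) f =
          ((1 - T) * V ^ (k + 1) * U ^ n) q + ((1 - T) * V ^ k * U ^ n) r := by
        have d1 : ((1 - T) * V ^ k * U ^ (n + 1)) f = ((1 - T) * V ^ k * U ^ n) (U f) := by
          rw [pow_succ, ← mul_assoc]; rfl
        have d2 : ((1 - T) * V ^ (k + 1) * U ^ n) q = ((1 - T) * V ^ k * U ^ n) (V q) := by
          have : (1 - T) * V ^ (k + 1) * U ^ n = ((1 - T) * V ^ k * U ^ n) * V := by
            rw [pow_succ]
            simp only [mul_assoc]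
            rw [(hVU.pow_right n).eq]
          rw [this]; rfl
        rw [d1, d2, hUf, map_add]
      rw [hdec]
      have n0 := norm_add_le (((1 - T) * V ^ (k + 1) * U ^ n) q) (((1 - T) * V ^ k * U ^ n) r)
      have n1 := ((1 - T) * V ^ (k + 1) * U ^ n).le_opNorm q
      have n2 := ((1 - T) * V ^ k * U ^ n).le_opNorm r
      rw [hrn] at n2
      have n3 := mul_nonneg (sub_nonneg.2 hk) (sub_nonneg.2 hqn)
      refine n0.trans ((add_le_add n1 n2).trans ?_)
      linarith)
    (by
      refine hVlim.congr fun k => ?_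
      simp only [pow_zero, mul_one]
      rw [(hDV.pow_right k).eq])
  obtain ⟨r, hr0, hr, hlim⟩ := zt_lim (fun n : ℕ => ‖T ^ (n + 1) - T ^ n‖)
    (antitone_nat_of_succ_le fun n => by
      have : T ^ (n + 1 + 1) - T ^ (n + 1) = T * (T ^ (n + 1) - T ^ n) := by
        rw [mul_sub, ← pow_succ', ← pow_succ']
      rw [this]; exact zt_mul _ _ hTnorm) (fun _ => norm_nonneg _)
  have hr' : r ≤ 0 := by
    refine ge_of_tendsto' key fun n => ?_
    have := hr ((m + 1) * n)
    have e : (1 - T) * V ^ 0 * U ^ n = -(T ^ ((m + 1) * n + 1) - T ^ ((m + 1) * n)) := by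
      rw [pow_zero, mul_one, hU, ← pow_mul, sub_mul, one_mul, ← pow_succ']; abel
    rw [e, norm_neg]
    exact this
  rw [le_antisymm hr' hr0] at hlim
  exact hlim
end

section
/- Let T be a positive contraction of L¹(μ). If ‖T^{m+1} − T^m‖ < 2 for some m ∈ ℕ, then ‖T^{m+1} − (T^{m+1} ∧ T^m)‖ < 1. -/
open MeasureTheory Filter

/-- `C` is the lattice infimum `A ∧ B` in the ordered space of operators on `L¹`:
the greatest operator `≤ A` and `≤ B` for the positivity order. -/
def IsOpInf {X : Type*} [MeasurableSpace X] {μ : Measure X}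
    (A B C : Lp ℝ 1 μ →L[ℝ] Lp ℝ 1 μ) : Prop :=
  (∀ f : Lp ℝ 1 μ, 0 ≤ f → C f ≤ A f) ∧ (∀ f : Lp ℝ 1 μ, 0 ≤ f → C f ≤ B f) ∧
    ∀ D : Lp ℝ 1 μ →L[ℝ] Lp ℝ 1 μ,
      (∀ f : Lp ℝ 1 μ, 0 ≤ f → D f ≤ A f) → (∀ f : Lp ℝ 1 μ, 0 ≤ f → D f ≤ B f) →
        ∀ f : Lp ℝ 1 μ, 0 ≤ f → D f ≤ C f

section Abstract

variable {E : Type*} [NormedAddCommGroup E] [Lattice E] [HasSolidNorm E]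
  [IsOrderedAddMonoid E]

theorem aux_nonneg_half {x : E} (h : 0 ≤ x + x) : 0 ≤ x := by
  have h1 : -x ≤ x := by
    have := add_le_add_left h (-x)
    simpa using this
  have h2 : |x| = x := sup_eq_left.mpr h1
  rw [← h2]; exact abs_nonneg x

theorem aux_norm_mono {x y : E} (hx : 0 ≤ x) (hxy : x ≤ y) : ‖x‖ ≤ ‖y‖ := by
  apply norm_le_norm_of_abs_le_abs
  rwa [abs_of_nonneg hx, abs_of_nonneg (hx.trans hxy)]

/-- directed norm bounded sets of nonnegative elements have a supremum -/
theorem aux_lub [CompleteSpace E]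
    (hadd : ∀ x y : E, 0 ≤ x → 0 ≤ y → ‖x + y‖ = ‖x‖ + ‖y‖)
    (s : Set E) (hne : s.Nonempty) (hdir : DirectedOn (· ≤ ·) s) (hpos : ∀ x ∈ s, 0 ≤ x)
    (K : ℝ) (hK : ∀ x ∈ s, ‖x‖ ≤ K) : ∃ g, IsLUB s g ∧ ‖g‖ ≤ K := by
  have : Nonempty s := hne.to_subtype
  have : IsDirectedOrder s := ⟨fun a b => by
    obtain ⟨c, hc, h1, h2⟩ := hdir a a.2 b b.2
    exact ⟨⟨c, hc⟩, h1, h2⟩⟩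
  have : OrderClosedTopology E := HasSolidNorm.orderClosedTopology
  have hbdd : BddAbove (Set.range fun x : s => ‖(x : E)‖) :=
    ⟨K, by rintro _ ⟨x, rfl⟩; exact hK x x.2⟩
  have hc : Cauchy (map (fun x : s => (x : E)) atTop) := by
    rw [Metric.cauchy_iff]
    refine ⟨inferInstance, fun ε hε => ?_⟩
    obtain ⟨a, ha⟩ := exists_lt_of_lt_ciSup
      (show (⨆ x : s, ‖(x : E)‖) - ε / 2 < ⨆ x : s, ‖(x : E)‖ by linarith)
    have key : ∀ x : s, a ≤ x → ‖(x : E) - a‖ < ε / 2 := by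
      intro x hx
      have h1 := hadd (x - a) a (sub_nonneg.mpr hx) (hpos a a.2)
      rw [sub_add_cancel] at h1
      have h2 := le_ciSup hbdd x
      linarith
    refine ⟨(fun x : s => (x : E)) '' Set.Ici a, image_mem_map (Ici_mem_atTop a), ?_⟩
    rintro _ ⟨x, hx, rfl⟩ _ ⟨y, hy, rfl⟩
    have h1 := key x hx
    have h2 := key y hy
    rw [← dist_eq_norm] at h1 h2
    have := dist_triangle_right (x : E) y a
    linarith
  obtain ⟨g, hg⟩ := CompleteSpace.complete hc
  have hg' : Tendsto (fun x : s => (x : E)) atTop (nhds g) := hg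
  refine ⟨g, ⟨fun x hx => ?_, fun b hb => ?_⟩, ?_⟩
  · exact ge_of_tendsto hg' ((eventually_ge_atTop (⟨x, hx⟩ : s)).mono fun y hy => hy)
  · exact le_of_tendsto' hg' fun y => hb y.2
  · exact le_of_tendsto' hg'.norm fun y => hK y y.2

variable [NormedSpace ℝ E]

/-- sums of `|S f_i|` over finite positive decompositions of `f` -/
inductive AuxP (S : E →L[ℝ] E) : E → E → Prop
  | base (f : E) (hf : 0 ≤ f) : AuxP S f |S f|
  | add (f g u v : E) (h1 : AuxP S f u) (h2 : AuxP S g v) : AuxP S (f + g) (u + v)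

variable (S : E →L[ℝ] E)

theorem AuxP.nonneg {S : E →L[ℝ] E} {f u : E} (h : AuxP S f u) : 0 ≤ f ∧ 0 ≤ u := by
  induction h with
  | base f hf => exact ⟨hf, abs_nonneg _⟩
  | add f g u v _ _ h1 h2 => exact ⟨add_nonneg h1.1 h2.1, add_nonneg h1.2 h2.2⟩

theorem AuxP.abs_le {S : E →L[ℝ] E} {f u : E} (h : AuxP S f u) : |S f| ≤ u := by
  induction h with
  | base f hf => exact le_rfl
  | add f g u v _ _ h1 h2 =>
    rw [map_add]
    exact (abs_add_le _ _).trans (add_le_add h1 h2)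

theorem AuxP.norm_le {S : E →L[ℝ] E}
    (hadd : ∀ x y : E, 0 ≤ x → 0 ≤ y → ‖x + y‖ = ‖x‖ + ‖y‖)
    {f u : E} (h : AuxP S f u) : ‖u‖ ≤ ‖S‖ * ‖f‖ := by
  induction h with
  | base f hf => rw [norm_abs_eq_norm]; exact S.le_opNorm f
  | add f g u v p q h1 h2 =>
    rw [hadd f g p.nonneg.1 q.nonneg.1, mul_add]
    exact (norm_add_le _ _).trans (add_le_add h1 h2)

theorem AuxP.split {S : E →L[ℝ] E} {f v : E} (h : AuxP S f v) :
    ∀ f1 f2 : E, 0 ≤ f1 → 0 ≤ f2 → f = f1 + f2 →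
      ∃ v1 v2, AuxP S f1 v1 ∧ AuxP S f2 v2 ∧ v ≤ v1 + v2 := by
  induction h with
  | base f hf =>
    rintro f1 f2 h1 h2 rfl
    refine ⟨_, _, AuxP.base f1 h1, AuxP.base f2 h2, ?_⟩
    rw [map_add]; exact abs_add_le _ _
  | add g1 g2 u v p q ih1 ih2 =>
    intro f1 f2 h1 h2 h
    have hg1 := p.nonneg.1
    have hg2 := q.nonneg.1
    have e22 : 0 ≤ f2 - (g1 - f1 ⊓ g1) := by
      have : g1 - f2 ≤ f1 ⊓ g1 := by
        refine le_inf ?_ ?_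
        · rw [sub_le_iff_le_add, ← h]; exact le_add_of_nonneg_right hg2
        · exact sub_le_self _ h2
      have h3 : f2 - (g1 - f1 ⊓ g1) = f1 ⊓ g1 - (g1 - f2) := by abel
      rw [h3]; exact sub_nonneg.mpr this
    obtain ⟨a, b, pa, pb, hab⟩ := ih1 (f1 ⊓ g1) (g1 - f1 ⊓ g1) (le_inf h1 hg1)
      (sub_nonneg.mpr inf_le_right) (by abel)
    obtain ⟨c, d, pc, pd, hcd⟩ := ih2 (f1 - f1 ⊓ g1) (f2 - (g1 - f1 ⊓ g1))
      (sub_nonneg.mpr inf_le_left) e22 (by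
        have : g2 = f1 + f2 - g1 := by rw [← h]; abel
        rw [this]; abel)
    refine ⟨a + c, b + d, ?_, ?_, ?_⟩
    · have := AuxP.add _ _ _ _ pa pc
      rwa [show f1 ⊓ g1 + (f1 - f1 ⊓ g1) = f1 by abel] at this
    · have := AuxP.add _ _ _ _ pb pd
      rwa [show (g1 - f1 ⊓ g1) + (f2 - (g1 - f1 ⊓ g1)) = f2 by abel] at this
    · calc u + v ≤ (a + b) + (c + d) := add_le_add hab hcd
        _ = _ := by abel

theorem AuxP.directed {S : E →L[ℝ] E} {f u : E} (h : AuxP S f u) :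
    ∀ v, AuxP S f v → ∃ w, AuxP S f w ∧ u ≤ w ∧ v ≤ w := by
  induction h with
  | base f hf => exact fun v hv => ⟨v, hv, hv.abs_le, le_rfl⟩
  | add f g u1 u2 p q ih1 ih2 =>
    intro v hv
    obtain ⟨v1, v2, p1, p2, hle⟩ := hv.split f g p.nonneg.1 q.nonneg.1 rfl
    obtain ⟨w1, q1, a1, b1⟩ := ih1 v1 p1
    obtain ⟨w2, q2, a2, b2⟩ := ih2 v2 p2
    exact ⟨w1 + w2, AuxP.add _ _ _ _ q1 q2, add_le_add a1 a2, hle.trans (add_le_add b1 b2)⟩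

theorem aux_modulus [CompleteSpace E]
    (hadd : ∀ x y : E, 0 ≤ x → 0 ≤ y → ‖x + y‖ = ‖x‖ + ‖y‖) :
    ∃ R : E →L[ℝ] E, ∀ f, 0 ≤ f → |S f| ≤ R f ∧ ‖R f‖ ≤ ‖S‖ * ‖f‖ := by
  have hex : ∀ f : E, ∃ g, 0 ≤ f → IsLUB {u | AuxP S f u} g ∧ ‖g‖ ≤ ‖S‖ * ‖f‖ := by
    intro f
    by_cases hf : 0 ≤ f
    · obtain ⟨g, hg⟩ := aux_lub hadd {u | AuxP S f u} ⟨_, AuxP.base f hf⟩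
        (fun u hu v hv => AuxP.directed hu v hv) (fun u hu => hu.nonneg.2)
        (‖S‖ * ‖f‖) (fun u hu => hu.norm_le hadd)
      exact ⟨g, fun _ => hg⟩
    · exact ⟨0, fun h => absurd h hf⟩
  choose r hr using hex
  have radd : ∀ f g, 0 ≤ f → 0 ≤ g → r (f + g) = r f + r g := by
    intro f g hf hg
    apply le_antisymm
    · refine (hr (f + g) (add_nonneg hf hg)).1.2 ?_
      intro u hu
      obtain ⟨v1, v2, p1, p2, hle⟩ := AuxP.split hu f g hf hg rfl
      exact hle.trans (add_le_add ((hr f hf).1.1 p1) ((hr g hg).1.1 p2))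
    · rw [← le_sub_iff_add_le]
      refine (hr f hf).1.2 ?_
      intro u hu
      rw [le_sub_comm]
      refine (hr g hg).1.2 ?_
      intro v hv
      rw [le_sub_iff_add_le, add_comm]
      exact (hr (f + g) (add_nonneg hf hg)).1.1 (AuxP.add _ _ _ _ hu hv)
  have rdiff : ∀ a b c d, 0 ≤ a → 0 ≤ b → 0 ≤ c → 0 ≤ d → a - b = c - d →
      r a - r b = r c - r d := by
    intro a b c d ha hb hc hd h
    have h1 : a + d = c + b := by
      rwa [sub_eq_sub_iff_add_eq_add] at h
    rw [sub_eq_sub_iff_add_eq_add, ← radd a d ha hd, ← radd c b hc hb, h1]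
  have r0 : r 0 = 0 := by simpa using radd 0 0 le_rfl le_rfl
  let φ : E →+ E := AddMonoidHom.mk' (fun f => r f⁺ - r f⁻) (by
    intro f g
    rw [rdiff (f + g)⁺ (f + g)⁻ (f⁺ + g⁺) (f⁻ + g⁻) (posPart_nonneg _) (negPart_nonneg _)
      (add_nonneg (posPart_nonneg _) (posPart_nonneg _))
      (add_nonneg (negPart_nonneg _) (negPart_nonneg _)),
      radd _ _ (posPart_nonneg _) (posPart_nonneg _),
      radd _ _ (negPart_nonneg _) (negPart_nonneg _)]
    · abel
    · rw [posPart_sub_negPart, add_sub_add_comm, posPart_sub_negPart, posPart_sub_negPart])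
  have hb : ∀ f, ‖φ f‖ ≤ ‖S‖ * ‖f‖ := by
    intro f
    calc ‖r f⁺ - r f⁻‖ ≤ ‖r f⁺‖ + ‖r f⁻‖ := norm_sub_le _ _
      _ ≤ ‖S‖ * ‖f⁺‖ + ‖S‖ * ‖f⁻‖ :=
        add_le_add (hr _ (posPart_nonneg _)).2 (hr _ (negPart_nonneg _)).2
      _ = ‖S‖ * ‖f‖ := by
        rw [← mul_add, ← hadd _ _ (posPart_nonneg _) (negPart_nonneg _), posPart_add_negPart,
          norm_abs_eq_norm]
  refine ⟨φ.toRealLinearMap (AddMonoidHomClass.continuous_of_bound φ ‖S‖ hb), fun f hf => ?_⟩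
  have e : φ f = r f := by
    change r f⁺ - r f⁻ = r f
    rw [posPart_of_nonneg hf, negPart_of_nonneg hf, r0, sub_zero]
  rw [AddMonoidHom.coe_toRealLinearMap, e]
  exact ⟨(hr f hf).1.1 (AuxP.base f hf), (hr f hf).2⟩

theorem aux_main [CompleteSpace E]
    (hadd : ∀ x y : E, 0 ≤ x → 0 ≤ y → ‖x + y‖ = ‖x‖ + ‖y‖)
    (A B C : E →L[ℝ] E)
    (hA : ∀ f, 0 ≤ f → 0 ≤ A f) (hB : ∀ f, 0 ≤ f → 0 ≤ B f)
    (hAB : ∀ f, 0 ≤ f → ‖A f‖ ≤ ‖B f‖)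
    (hCA : ∀ f, 0 ≤ f → C f ≤ A f) (hCB : ∀ f, 0 ≤ f → C f ≤ B f)
    (hC : ∀ D : E →L[ℝ] E, (∀ f, 0 ≤ f → D f ≤ A f) → (∀ f, 0 ≤ f → D f ≤ B f) →
      ∀ f, 0 ≤ f → D f ≤ C f) : ‖A - C‖ ≤ ‖A - B‖ / 2 := by
  have hC0 : ∀ f, 0 ≤ f → 0 ≤ C f := fun f hf => by
    simpa using hC 0 (by simpa using hA) (by simpa using hB) f hf
  obtain ⟨R, hR⟩ := aux_modulus (A - B) hadd
  let D : E →L[ℝ] E := (2⁻¹ : ℝ) • (A + B - R)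
  have hD : ∀ f, D f + D f = A f + B f - R f := by
    intro f
    change (2⁻¹ : ℝ) • (A f + B f - R f) + (2⁻¹ : ℝ) • (A f + B f - R f) = _
    rw [← add_smul]; norm_num
  have hDC : ∀ f, 0 ≤ f → D f ≤ C f := by
    apply hC D
    · intro f hf
      rw [← sub_nonneg]
      apply aux_nonneg_half
      have h1 : -(A f - B f) ≤ R f := (neg_le_abs _).trans (hR f hf).1
      have h2 : (A f - D f) + (A f - D f) = R f - -(A f - B f) := by
        rw [sub_add_sub_comm, hD]; abel
      rw [h2]; exact sub_nonneg.mpr h1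
    · intro f hf
      rw [← sub_nonneg]
      apply aux_nonneg_half
      have h1 : (A f - B f) ≤ R f := (le_abs_self _).trans (hR f hf).1
      have h2 : (B f - D f) + (B f - D f) = R f - (A f - B f) := by
        rw [sub_add_sub_comm, hD]; abel
      rw [h2]; exact sub_nonneg.mpr h1
  have hpos : ∀ f, 0 ≤ f → ‖(A - C) f‖ ≤ ‖A - B‖ / 2 * ‖f‖ := by
    intro f hf
    have pA : 0 ≤ A f - C f := sub_nonneg.mpr (hCA f hf)
    have pB : 0 ≤ B f - C f := sub_nonneg.mpr (hCB f hf)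
    have h1 : (A f - C f) + (B f - C f) ≤ R f := by
      have := add_le_add (hDC f hf) (hDC f hf)
      rw [hD, sub_le_iff_le_add] at this
      rw [sub_add_sub_comm, sub_le_iff_le_add, add_comm (R f)]
      exact this
    have h2 := aux_norm_mono (add_nonneg pA pB) h1
    rw [hadd _ _ pA pB] at h2
    have h3 := hadd _ _ pA (hC0 f hf)
    have h4 := hadd _ _ pB (hC0 f hf)
    rw [sub_add_cancel] at h3 h4
    have h5 := hAB f hf
    have h6 := (hR f hf).2
    change ‖A f - C f‖ ≤ _
    linarith
  refine ContinuousLinearMap.opNorm_le_bound _ (by positivity) fun f => ?_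
  calc ‖(A - C) f‖ = ‖(A - C) f⁺ - (A - C) f⁻‖ := by rw [← map_sub, posPart_sub_negPart]
    _ ≤ ‖(A - C) f⁺‖ + ‖(A - C) f⁻‖ := norm_sub_le _ _
    _ ≤ ‖A - B‖ / 2 * ‖f⁺‖ + ‖A - B‖ / 2 * ‖f⁻‖ :=
      add_le_add (hpos _ (posPart_nonneg _)) (hpos _ (negPart_nonneg _))
    _ = ‖A - B‖ / 2 * ‖f‖ := by
        rw [← mul_add, ← hadd _ _ (posPart_nonneg _) (negPart_nonneg _), posPart_add_negPart,
          norm_abs_eq_norm]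

end Abstract

theorem aux_L1_add {X : Type*} [MeasurableSpace X] {μ : Measure X} (f g : Lp ℝ 1 μ)
    (hf : 0 ≤ f) (hg : 0 ≤ g) : ‖f + g‖ = ‖f‖ + ‖g‖ := by
  rw [L1.norm_eq_integral_norm, L1.norm_eq_integral_norm, L1.norm_eq_integral_norm,
    ← integral_add (L1.integrable_coeFn f).norm (L1.integrable_coeFn g).norm]
  apply integral_congr_ae
  filter_upwards [Lp.coeFn_add f g, (Lp.coeFn_nonneg f).mpr hf, (Lp.coeFn_nonneg g).mpr hg]
    with x h1 h2 h3
  simp only [Pi.zero_apply] at h2 h3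
  rw [h1, Pi.add_apply, Real.norm_of_nonneg h2, Real.norm_of_nonneg h3,
    Real.norm_of_nonneg (add_nonneg h2 h3)]

theorem stmt11 {X : Type*} [MeasurableSpace X] (μ : Measure X)
    (T : Lp ℝ 1 μ →L[ℝ] Lp ℝ 1 μ)
    (hTpos : ∀ f : Lp ℝ 1 μ, 0 ≤ f → 0 ≤ T f) (hTnorm : ‖T‖ ≤ 1)
    (m : ℕ) (hm : 1 ≤ m) (C : Lp ℝ 1 μ →L[ℝ] Lp ℝ 1 μ)
    (hC : IsOpInf (T ^ (m + 1)) (T ^ m) C)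
    (h : ‖T ^ (m + 1) - T ^ m‖ < 2) :
    ‖T ^ (m + 1) - C‖ < 1 := by
  have hpow : ∀ (n : ℕ) (f : Lp ℝ 1 μ), 0 ≤ f → 0 ≤ (T ^ n) f := by
    intro n
    induction n with
    | zero => intro f hf; simpa using hf
    | succ k ih =>
      intro f hf
      rw [pow_succ']
      exact hTpos _ (ih f hf)
  have hle : ∀ f : Lp ℝ 1 μ, 0 ≤ f → ‖(T ^ (m + 1)) f‖ ≤ ‖(T ^ m) f‖ := by
    intro f _
    rw [pow_succ']
    exact (T.le_of_opNorm_le hTnorm _).trans (one_mul _).le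
  have := aux_main aux_L1_add (T ^ (m + 1)) (T ^ m) C (hpow _) (hpow _) hle hC.1 hC.2.1 hC.2.2
  linarith
end
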